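/- Let Ľ ⊂ Λ_K3 be a nondegenerate primitive sublattice, let F ∈ Ľ be 1-admissible in Ľ, and let τ ∈ Ľ^⊥ be 1-admissible in Ľ^⊥. Then Ľ admits an orthogonal direct-sum decomposition Ľ = H′ ⊕ Γ with H′ isometric to the hyperbolic plane H and with F a primitive element of H′. Moreover, the inclusion Γ ↪ (ℤτ ⊕ ℤF)^⊥ factors as a composite of primitive isometric embeddings Γ ↪ N ↪ (ℤτ ⊕ ℤF)^⊥ with N isometric to H ⊕ E₈ ⊕ E₈, such that the composition of N ↪ (ℤτ ⊕ ℤF)^⊥ with the quotient map (ℤτ ⊕ ℤF)^⊥ → (ℤτ ⊕ ℤF)^⊥/(ℤτ ⊕ ℤF) is an isomorphism of lattices. -/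

import Mathlib

/- Background definitions: integral lattices, the hyperbolic plane `H`, the
   `E₈` lattice, the K3 lattice `Λ_K3 = H ⊕ H ⊕ H ⊕ E₈ ⊕ E₈`, primitivity,
   isotropy, and (doubly) admissible classes. -/

namespace DF

/-- Integer bilinear form on a `ℤ`-module. -/
abbrev Bil (G : Type) [AddCommGroup G] := G →ₗ[ℤ] G →ₗ[ℤ] ℤ

section Defs

variable {G G' : Type} [AddCommGroup G] [AddCommGroup G']

/-- A primitive element of a free `ℤ`-module. -/
def PrimElt (p : G) : Prop := ∀ (n : ℤ) (x : G), p = n • x → IsUnit n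

/-- A primitive subgroup (torsion-free quotient). -/
def PrimSub (S : Submodule ℤ G) : Prop :=
  ∀ (n : ℤ) (x : G), n ≠ 0 → n • x ∈ S → x ∈ S

/-- `S` is a primitive subgroup of `T` (i.e. `T/S` is torsion-free). -/
def PrimIn (S T : Submodule ℤ G) : Prop :=
  ∀ (n : ℤ) (x : G), n ≠ 0 → x ∈ T → n • x ∈ S → x ∈ S

/-- `e` is a primitive element of the subgroup `S`. -/
def PrimEltIn (S : Submodule ℤ G) (e : G) : Prop :=
  ∀ (n : ℤ) (x : G), x ∈ S → e = n • x → IsUnit n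

/-- The bilinear form vanishes identically on `S`. -/
def IsotropicSub (B : Bil G) (S : Submodule ℤ G) : Prop :=
  ∀ x ∈ S, ∀ y ∈ S, B x y = 0

/-- The restriction of `B` to `S` is nondegenerate. -/
def NondegOn (B : Bil G) (S : Submodule ℤ G) : Prop :=
  ∀ x ∈ S, (∀ y ∈ S, B x y = 0) → x = 0

/-- The (two-sided) orthogonal complement of a submodule. -/
def perpSub (B : Bil G) (S : Submodule ℤ G) : Submodule ℤ G where
  carrier := {v | ∀ s ∈ S, B s v = 0 ∧ B v s = 0}
  zero_mem' := by intro s hs; simp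
  add_mem' := by
    intro x y hx hy s hs
    obtain ⟨h1, h2⟩ := hx s hs; obtain ⟨h3, h4⟩ := hy s hs
    constructor <;> simp [map_add, LinearMap.add_apply, h1, h2, h3, h4]
  smul_mem' := by
    intro c x hx s hs
    obtain ⟨h1, h2⟩ := hx s hs
    constructor <;> simp [map_smul, LinearMap.smul_apply, smul_eq_mul, h1, h2]

/-- The submodule `N` of `(G, B)` is isometric to the lattice `(G', B')`. -/
def IsometricTo (B : Bil G) (N : Submodule ℤ G) (B' : Bil G') : Prop :=
  ∃ e : G' ≃ₗ[ℤ] ↥N, ∀ u v : G', B ((e u : ↥N) : G) ((e v : ↥N) : G) = B' u v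

/-- `div(e) = m` in `S`: the image of `⟨e, -⟩ : S → ℤ` is generated by `m`. -/
def DivEq (B : Bil G) (S : Submodule ℤ G) (e : G) (m : ℤ) : Prop :=
  (∀ x ∈ S, m ∣ B e x) ∧ ∃ x ∈ S, B e x = m

/-- `e` is an `m`-admissible class of the (nondegenerate) lattice `S`:
    `e ∈ S` is primitive isotropic with `div(e) = m`, and there is an
    isotropic `g ∈ S` with `div(g) = m` and `⟨e, g⟩ = m`. -/
def MAdm (B : Bil G) (S : Submodule ℤ G) (e : G) (m : ℤ) : Prop :=
  e ∈ S ∧ PrimEltIn S e ∧ B e e = 0 ∧ DivEq B S e m ∧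
  ∃ g ∈ S, B g g = 0 ∧ DivEq B S g m ∧ B e g = m

/-- The rank-two isotropic sublattice `I` of `S` is doubly admissible in `S`:
    there are primitive generators `e₁, e₂` of `I` and isotropic classes
    `g₁, g₂ ∈ S` with `⟨e₁,g₁⟩ = ⟨e₂,g₂⟩ = 1` and `⟨e₁,g₂⟩ = ⟨e₂,g₁⟩ = 0`. -/
def DoublyAdm (B : Bil G) (S : Submodule ℤ G) (I : Submodule ℤ G) : Prop :=
  ∃ e₁ e₂ g₁ g₂ : G, e₁ ∈ S ∧ e₂ ∈ S ∧ g₁ ∈ S ∧ g₂ ∈ S ∧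
    PrimEltIn S e₁ ∧ PrimEltIn S e₂ ∧ I = Submodule.span ℤ {e₁, e₂} ∧
    B g₁ g₁ = 0 ∧ B g₂ g₂ = 0 ∧
    B e₁ g₁ = 1 ∧ B e₂ g₂ = 1 ∧ B e₁ g₂ = 0 ∧ B e₂ g₁ = 0

/-- Signature `(1, rank - 1)` for the sublattice `L`:
    there is a rationally spanning pairwise orthogonal family in `L` with one
    vector of positive square and `rank L - 1` of negative square. -/
def SigOneRest (B : Bil G) (L : Submodule ℤ G) : Prop :=
  1 ≤ Module.finrank ℤ ↥L ∧
  ∃ (v₀ : G) (w : Fin (Module.finrank ℤ ↥L - 1) → G),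
    v₀ ∈ L ∧ (∀ i, w i ∈ L) ∧ 0 < B v₀ v₀ ∧ (∀ i, B (w i) (w i) < 0) ∧
    (∀ i, B v₀ (w i) = 0) ∧ (∀ i j, i ≠ j → B (w i) (w j) = 0) ∧
    ∀ u ∈ L, ∃ m : ℤ, m ≠ 0 ∧ m • u ∈ Submodule.span ℤ (insert v₀ (Set.range w))

end Defs

section Lattices

variable {G₁ G₂ : Type} [AddCommGroup G₁] [AddCommGroup G₂]

/-- The orthogonal direct sum of two bilinear forms. -/
def prodForm (B₁ : Bil G₁) (B₂ : Bil G₂) : Bil (G₁ × G₂) :=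
  LinearMap.mk₂ ℤ (fun u v => B₁ u.1 v.1 + B₂ u.2 v.2)
    (by intro m₁ m₂ n; simp [map_add, LinearMap.add_apply]; ring)
    (by intro c m n; simp [map_smul, LinearMap.smul_apply, smul_eq_mul]; ring)
    (by intro m n₁ n₂; simp [map_add, LinearMap.add_apply]; ring)
    (by intro c m n; simp [map_smul, LinearMap.smul_apply, smul_eq_mul]; ring)

/-- The hyperbolic plane `H`: `ℤ²` with Gram matrix `!![0, 1; 1, 0]`. -/
def HForm : Bil (Fin 2 → ℤ) :=
  LinearMap.mk₂ ℤ (fun x y => x 0 * y 1 + x 1 * y 0)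
    (by intro m₁ m₂ n; simp [Pi.add_apply]; ring)
    (by intro c m n; simp [Pi.smul_apply, smul_eq_mul]; ring)
    (by intro m n₁ n₂; simp [Pi.add_apply]; ring)
    (by intro c m n; simp [Pi.smul_apply, smul_eq_mul]; ring)

/-- The negative of the `E₈` Cartan matrix (Bourbaki numbering). -/
def E8Gram : Matrix (Fin 8) (Fin 8) ℤ :=
  !![-2,  0,  1,  0,  0,  0,  0,  0;
      0, -2,  0,  1,  0,  0,  0,  0;
      1,  0, -2,  1,  0,  0,  0,  0;
      0,  1,  1, -2,  1,  0,  0,  0;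
      0,  0,  0,  1, -2,  1,  0,  0;
      0,  0,  0,  0,  1, -2,  1,  0;
      0,  0,  0,  0,  0,  1, -2,  1;
      0,  0,  0,  0,  0,  0,  1, -2]

/-- The negative definite even unimodular root lattice `E₈`. -/
def E8Form : Bil (Fin 8 → ℤ) := Matrix.toLinearMap₂' ℤ E8Gram

/-- The underlying group of `H ⊕ H`. -/
abbrev HHtype := (Fin 2 → ℤ) × (Fin 2 → ℤ)

/-- The lattice `H ⊕ H`. -/
def HHForm : Bil HHtype := prodForm HForm HForm

/-- The underlying group of `H ⊕ E₈ ⊕ E₈`. -/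
abbrev HEEtype := (Fin 2 → ℤ) × (Fin 8 → ℤ) × (Fin 8 → ℤ)

/-- The lattice `H ⊕ E₈ ⊕ E₈`. -/
def HEEForm : Bil HEEtype := prodForm HForm (prodForm E8Form E8Form)

/-- The underlying group of the K3 lattice `Λ_K3 = H ⊕ H ⊕ H ⊕ E₈ ⊕ E₈`. -/
abbrev K3type := (Fin 2 → ℤ) × (Fin 2 → ℤ) × (Fin 2 → ℤ) × (Fin 8 → ℤ) × (Fin 8 → ℤ)

/-- The K3 lattice `Λ_K3 = H ⊕ H ⊕ H ⊕ E₈ ⊕ E₈`. -/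
def K3Form : Bil K3type :=
  prodForm HForm (prodForm HForm (prodForm HForm (prodForm E8Form E8Form)))

end Lattices

end DF

namespace DF

section Forms

variable {G G' : Type} [AddCommGroup G] [AddCommGroup G']

/-- The bilinear form `B` is symmetric. -/
def SymmForm (B : Bil G) : Prop := ∀ x y, B x y = B y x

/-- The bilinear form `B` is even. -/
def EvenForm (B : Bil G) : Prop := ∀ x, ∃ q, B x x = 2 * q

lemma prodForm_apply (B : Bil G) (B' : Bil G') (u v : G × G') :
    prodForm B B' u v = B u.1 v.1 + B' u.2 v.2 := rfl

lemma HForm_apply (x y : Fin 2 → ℤ) : HForm x y = x 0 * y 1 + x 1 * y 0 := rfl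

lemma SymmForm.prod {B : Bil G} {B' : Bil G'} (h : SymmForm B) (h' : SymmForm B') :
    SymmForm (prodForm B B') := fun x y => by
  rw [prodForm_apply, prodForm_apply, h, h']

lemma EvenForm.prod {B : Bil G} {B' : Bil G'} (h : EvenForm B) (h' : EvenForm B') :
    EvenForm (prodForm B B') := fun x => by
  obtain ⟨q, hq⟩ := h x.1
  obtain ⟨q', hq'⟩ := h' x.2
  exact ⟨q + q', by rw [prodForm_apply, hq, hq']; ring⟩

lemma symmForm_HForm : SymmForm HForm := fun x y => by
  rw [HForm_apply, HForm_apply]; ring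

lemma evenForm_HForm : EvenForm HForm := fun x => ⟨x 0 * x 1, by rw [HForm_apply]; ring⟩

lemma symmForm_E8Form : SymmForm E8Form := fun x y => by
  simp [E8Form, E8Gram, Matrix.toLinearMap₂'_apply, Fin.sum_univ_succ]
  ring

lemma evenForm_E8Form : EvenForm E8Form := fun x => by
  refine ⟨-(x 0 ^ 2 + x 1 ^ 2 + x 2 ^ 2 + x 3 ^ 2 + x 4 ^ 2 + x 5 ^ 2 + x 6 ^ 2 + x 7 ^ 2) +
    x 0 * x 2 + x 1 * x 3 + x 2 * x 3 + x 3 * x 4 + x 4 * x 5 + x 5 * x 6 + x 6 * x 7, ?_⟩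
  simp [E8Form, E8Gram, Matrix.toLinearMap₂'_apply, Fin.sum_univ_succ]
  ring

lemma symmForm_HEEForm : SymmForm HEEForm :=
  symmForm_HForm.prod (symmForm_E8Form.prod symmForm_E8Form)

lemma evenForm_HEEForm : EvenForm HEEForm :=
  evenForm_HForm.prod (evenForm_E8Form.prod evenForm_E8Form)

end Forms

section Cancellation

variable {L M K : Type} [AddCommGroup L] [AddCommGroup M] [AddCommGroup K]

/-- The orthogonal complement of `{v, w}` in `(L, B)` is isometric to `(M, BM)`. -/
def ComplIsometric (B : Bil L) (BM : Bil M) (v w : L) : Prop :=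
  ∃ e : M →ₗ[ℤ] L, Function.Injective e ∧ (∀ a b, B (e a) (e b) = BM a b) ∧
    ∀ z, (∃ a, e a = z) ↔ B v z = 0 ∧ B w z = 0

/-- `(v, w)` is a pair of isotropic vectors with `⟨v, w⟩ = 1`. -/
def HypPair (B : Bil L) (v w : L) : Prop := B v v = 0 ∧ B w w = 0 ∧ B v w = 1

lemma HypPair.symm {B : Bil L} (hB : SymmForm B) {v w : L} (h : HypPair B v w) :
    HypPair B w v := ⟨h.2.1, h.1, by rw [hB, h.2.2]⟩

lemma ComplIsometric.symm {B : Bil L} {BM : Bil M} {v w : L}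
    (h : ComplIsometric B BM v w) : ComplIsometric B BM w v := by
  obtain ⟨e, h₁, h₂, h₃⟩ := h
  exact ⟨e, h₁, h₂, fun z => (h₃ z).trans and_comm⟩

lemma ComplIsometric.neg {B : Bil L} {BM : Bil M} {v w : L}
    (h : ComplIsometric B BM v w) : ComplIsometric B BM (-v) (-w) := by
  obtain ⟨e, h₁, h₂, h₃⟩ := h
  exact ⟨e, h₁, h₂, fun z => (h₃ z).trans (by simp)⟩

/-- Both complements are identified with `v^⊥ / v`. -/
lemma ComplIsometric.change_right {B : Bil L} (hB : SymmForm B) {BM : Bil M} {v w w' : L}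
    (hw : HypPair B v w) (hw' : HypPair B v w') (h : ComplIsometric B BM v w) :
    ComplIsometric B BM v w' := by
  obtain ⟨e, h₁, h₂, h₃⟩ := h
  obtain ⟨hvv, hww, hvw⟩ := hw
  obtain ⟨-, hww', hvw'⟩ := hw'
  have hwv : B w v = 1 := by rw [hB, hvw]
  have hwv' : B w' v = 1 := by rw [hB, hvw']
  have hve : ∀ a, B v (e a) = 0 := fun a => ((h₃ _).1 ⟨a, rfl⟩).1
  have hwe : ∀ a, B w (e a) = 0 := fun a => ((h₃ _).1 ⟨a, rfl⟩).2
  have hev : ∀ a, B (e a) v = 0 := fun a => by rw [hB, hve]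
  let e' : M →ₗ[ℤ] L := e - ((B w').comp e).smulRight v
  have he' : ∀ a, e' a = e a - B w' (e a) • v := fun a => rfl
  refine ⟨e', ?_, fun a b => ?_, fun z => ⟨?_, ?_⟩⟩
  · rw [injective_iff_map_eq_zero]
    intro a ha
    rw [he'] at ha
    have hc : B w' (e a) = 0 := by
      have := congrArg (B w) ha
      simpa [hwe, hwv] using this
    rw [hc, zero_smul, sub_zero] at ha
    exact (injective_iff_map_eq_zero e).1 h₁ a ha
  · simp [he', hve, hev, hvv, h₂]
  · rintro ⟨a, rfl⟩
    simp [he', hve, hvv, hwv']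
  · rintro ⟨hz, hz'⟩
    obtain ⟨a, ha⟩ := (h₃ (z - B w z • v)).2 ⟨by simp [hz, hvv], by simp [hwv]⟩
    refine ⟨a, ?_⟩
    rw [he', ha]
    simp [hz', hwv']

/-- `x` belongs to a hyperbolic pair with orthogonal complement isometric to `(M, BM)`. -/
def HypSplit (B : Bil L) (BM : Bil M) (x : L) : Prop :=
  ∃ y, HypPair B x y ∧ ComplIsometric B BM x y

lemma HypSplit.complIsometric {B : Bil L} (hB : SymmForm B) {BM : Bil M} {x y : L}
    (hx : HypSplit B BM x) (hxy : HypPair B x y) : ComplIsometric B BM x y := by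
  obtain ⟨y', h, h'⟩ := hx
  exact h'.change_right hB h hxy

lemma HypSplit.step {B : Bil L} (hB : SymmForm B) {BM : Bil M} {x y : L}
    (hx : HypSplit B BM x) (hxy : HypPair B x y) : HypSplit B BM y :=
  ⟨x, hxy.symm hB, (hx.complIsometric hB hxy).symm⟩

lemma HypSplit.neg {B : Bil L} {BM : Bil M} {x : L} (hx : HypSplit B BM x) :
    HypSplit B BM (-x) := by
  obtain ⟨y, ⟨h₁, h₂, h₃⟩, h'⟩ := hx
  exact ⟨-y, ⟨by simpa using h₁, by simpa using h₂, by simpa using h₃⟩, h'.neg⟩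

/-- If `|φ x|` is the smallest nonzero absolute value that a linear form `φ` takes on vectors
splitting off a hyperbolic plane with complement `H ⊕ K`, then `φ x` divides all values of `φ`. -/
lemma HypSplit.dvd_of_minimal {B : Bil L} (hB : SymmForm B) (hev : EvenForm B) {BK : Bil K}
    (φ : L →ₗ[ℤ] ℤ) {x : L} (hx : HypSplit B (prodForm HForm BK) x)
    (hmin : ∀ x', HypSplit B (prodForm HForm BK) x' → φ x' ≠ 0 → φ x ≠ 0 ∧ |φ x| ≤ |φ x'|)
    (z : L) : φ x ∣ φ z := by
  have key : ∀ c : ℤ, (∀ t : ℤ, ∃ x', HypSplit B (prodForm HForm BK) x' ∧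
      φ x' = c + t * φ x) → φ x ∣ c := by
    intro c hc
    obtain ⟨x', hx', hφ⟩ := hc (-(c / φ x))
    have hr : φ x' = c % φ x := by
      rw [hφ, Int.emod_def]; ring
    by_contra hnd
    have h0 : φ x' ≠ 0 := fun h => hnd (Int.dvd_of_emod_eq_zero (hr ▸ h))
    obtain ⟨h1, h2⟩ := hmin x' hx' h0
    have h3 := Int.emod_lt_abs c h1
    rw [hr, abs_of_nonneg (Int.emod_nonneg c h1)] at h2
    omega
  obtain ⟨y, hxy, e, -, he, hrange⟩ := id hx
  have hy := hx.step hB hxy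
  obtain ⟨hxx, hyy, hxy1⟩ := id hxy
  have hyx : B y x = 1 := by rw [hB, hxy1]
  have hxe : ∀ a, B x (e a) = 0 := fun a => ((hrange _).1 ⟨a, rfl⟩).1
  have hye : ∀ a, B y (e a) = 0 := fun a => ((hrange _).1 ⟨a, rfl⟩).2
  have hex : ∀ a, B (e a) x = 0 := fun a => by rw [hB, hxe]
  have hey : ∀ a, B (e a) y = 0 := fun a => by rw [hB, hye]
  obtain ⟨p, hp⟩ : ∃ p, e (![1, 0], 0) = p := ⟨_, rfl⟩
  obtain ⟨r, hr⟩ : ∃ r, e (![0, 1], 0) = r := ⟨_, rfl⟩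
  have hxp : B x p = 0 := hp ▸ hxe _
  have hxr : B x r = 0 := hr ▸ hxe _
  have hyp : B y p = 0 := hp ▸ hye _
  have hyr : B y r = 0 := hr ▸ hye _
  have hpx : B p x = 0 := hp ▸ hex _
  have hrx : B r x = 0 := hr ▸ hex _
  have hpy : B p y = 0 := hp ▸ hey _
  have hry : B r y = 0 := hr ▸ hey _
  have hpp : B p p = 0 := by simp [← hp, he, prodForm_apply, HForm_apply]
  have hrr : B r r = 0 := by simp [← hr, he, prodForm_apply, HForm_apply]
  have hpr : B p r = 1 := by simp [← hp, ← hr, he, prodForm_apply, HForm_apply]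
  have hrp : B r p = 1 := by rw [hB, hpr]
  have hpk : ∀ k, B p (e (0, k)) = 0 := fun k => by simp [← hp, he, prodForm_apply, HForm_apply]
  have hrk : ∀ k, B r (e (0, k)) = 0 := fun k => by simp [← hr, he, prodForm_apply, HForm_apply]
  have hkp : ∀ k, B (e (0, k)) p = 0 := fun k => by rw [hB, hpk]
  have hkr : ∀ k, B (e (0, k)) r = 0 := fun k => by rw [hB, hrk]
  have hrx' : HypSplit B (prodForm HForm BK) (r + x) :=
    hy.step hB ⟨hyy, by simp [*], by simp [*]⟩
  have hP : HypSplit B (prodForm HForm BK) p :=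
    hrx'.step hB ⟨by simp [*], hpp, by simp [*]⟩
  have hR : HypSplit B (prodForm HForm BK) r := hP.step hB ⟨hpp, hrr, hpr⟩
  have dp : φ x ∣ φ p := key _ fun t =>
    ⟨p + t • x, hR.step hB ⟨hrr, by simp [*], by simp [*]⟩, by simp⟩
  have dr : φ x ∣ φ r := key _ fun t =>
    ⟨r + t • x, hP.step hB ⟨hpp, by simp [*], by simp [*]⟩, by simp⟩
  have dk : ∀ k, φ x ∣ φ (e (0, k)) := by
    intro k
    obtain ⟨q, hq⟩ := hev (e (0, k))
    have hd : φ x ∣ φ p + φ (e (0, k)) - q * φ r := key _ fun t =>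
      ⟨p + e (0, k) - q • r + t • x,
        hR.step hB ⟨hrr, by
          simp only [map_add, map_sub, map_smul, LinearMap.add_apply, LinearMap.sub_apply,
            LinearMap.smul_apply, smul_eq_mul, hpp, hpk, hpr, hpx, hkp, hq, hkr, hex, hrp, hrk,
            hrr, hrx, hxp, hxe, hxr, hxx]
          ring, by simp [*]⟩, by simp⟩
    rw [show φ (e (0, k)) = φ p + φ (e (0, k)) - q * φ r - φ p + q * φ r by ring]
    exact dvd_add (dvd_sub hd dp) (dr.mul_left q)
  have dy : φ x ∣ φ y := by
    obtain ⟨m, hm⟩ := dp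
    obtain ⟨n, hn⟩ := dr
    refine key _ fun t => ⟨y + (n + 1) • p + ((n + 1) * m - t) • r
      - ((n + 1) * ((n + 1) * m - t)) • x, hx.step hB ⟨hxx, ?_, ?_⟩, ?_⟩
    · simp only [map_add, map_sub, map_smul, LinearMap.add_apply, LinearMap.sub_apply,
        LinearMap.smul_apply, smul_eq_mul, hyy, hyp, hyr, hyx, hpy, hpp, hpr, hpx, hry, hrp, hrr,
        hrx, hxy1, hxp, hxr, hxx]
      ring
    · simp [*]
    · simp only [map_add, map_sub, map_smul, smul_eq_mul, hm, hn]
      ring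
  obtain ⟨⟨c, k⟩, ha⟩ := (hrange (z - B y z • x - B x z • y)).2
    ⟨by simp [*], by simp [*]⟩
  have hck : ((c, k) : (Fin 2 → ℤ) × K) = c 0 • (![1, 0], 0) + c 1 • (![0, 1], 0) + (0, k) := by
    refine Prod.ext ?_ (by simp)
    funext i
    fin_cases i <;> simp
  have hz : z = B y z • x + B x z • y + (c 0 • p + c 1 • r + e (0, k)) := by
    rw [← hp, ← hr, ← map_smul, ← map_smul, ← map_add, ← map_add, ← hck, ha]
    abel
  rw [hz]
  simp only [map_add, map_smul, smul_eq_mul]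
  exact dvd_add (dvd_add (Dvd.intro_left _ rfl) (dy.mul_left _))
    (dvd_add (dvd_add (dp.mul_left _) (dr.mul_left _)) (dk k))

/-- If some hyperbolic plane in an even lattice has complement isometric to `H ⊕ K`, then so
does every hyperbolic plane. -/
theorem ComplIsometric.of_hypPair {B : Bil L} (hB : SymmForm B) (hev : EvenForm B) {BK : Bil K}
    {x y v w : L} (hxy : HypPair B x y) (h : ComplIsometric B (prodForm HForm BK) x y)
    (hvw : HypPair B v w) : ComplIsometric B (prodForm HForm BK) v w := by
  obtain ⟨a, ha, hmin⟩ : ∃ a, HypSplit B (prodForm HForm BK) a ∧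
      ∀ x', HypSplit B (prodForm HForm BK) x' → B v x' ≠ 0 → B v a ≠ 0 ∧ |B v a| ≤ |B v x'| := by
    by_cases hex : ∃ a, HypSplit B (prodForm HForm BK) a ∧ B v a ≠ 0
    · let S : Set L := {a | HypSplit B (prodForm HForm BK) a ∧ B v a ≠ 0}
      have hS : S.Nonempty := hex
      let f : L → ℕ := fun a => (B v a).natAbs
      have hmem := Function.argminOn_mem f S hS
      refine ⟨Function.argminOn f S hS, hmem.1, fun x' hx' h0 => ⟨hmem.2, ?_⟩⟩
      have hle : f (Function.argminOn f S hS) ≤ f x' :=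
        Function.argminOn_le f S ⟨hx', h0⟩
      rw [Int.abs_eq_natAbs, Int.abs_eq_natAbs]
      exact_mod_cast hle
    · exact ⟨x, ⟨y, hxy, h⟩, fun x' hx' h0 => (hex ⟨x', hx', h0⟩).elim⟩
  have hd : B v a ∣ 1 := by
    have := HypSplit.dvd_of_minimal hB hev (B v) ha hmin w
    rwa [hvw.2.2] at this
  obtain ⟨b, hb, hvb⟩ : ∃ b, HypSplit B (prodForm HForm BK) b ∧ B v b = 1 := by
    rcases Int.isUnit_iff.1 (isUnit_of_dvd_one hd) with h1 | h1
    · exact ⟨a, ha, h1⟩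
    · exact ⟨-a, ha.neg, by simp [h1]⟩
  have hbv : HypPair B b v := by
    obtain ⟨_, hb', _⟩ := id hb
    exact ⟨hb'.1, hvw.1, by rw [hB, hvb]⟩
  exact (hb.step hB hbv).complIsometric hB hvw

/-- Cancellation: in `H ⊕ H ⊕ K` with `K` even, every hyperbolic plane has orthogonal
complement isometric to `H ⊕ K`. -/
theorem complIsometric_prodForm {BK : Bil K} (hK : SymmForm BK) (hK' : EvenForm BK)
    {v w : (Fin 2 → ℤ) × (Fin 2 → ℤ) × K}
    (hvw : HypPair (prodForm HForm (prodForm HForm BK)) v w) :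
    ComplIsometric (prodForm HForm (prodForm HForm BK)) (prodForm HForm BK) v w := by
  refine ComplIsometric.of_hypPair (x := (![1, 0], 0)) (y := (![0, 1], 0))
    (symmForm_HForm.prod (symmForm_HForm.prod hK)) (evenForm_HForm.prod (evenForm_HForm.prod hK'))
    ⟨by simp [prodForm_apply, HForm_apply], by simp [prodForm_apply, HForm_apply],
      by simp [prodForm_apply, HForm_apply]⟩
    ⟨LinearMap.inr ℤ _ _, LinearMap.inr_injective, fun a b => by simp [prodForm_apply],
      fun z => ⟨?_, ?_⟩⟩ hvw
  · rintro ⟨a, rfl⟩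
    simp [prodForm_apply, HForm_apply]
  · rintro ⟨h₁, h₂⟩
    refine ⟨z.2, Prod.ext ?_ rfl⟩
    funext i
    fin_cases i
    · simpa [prodForm_apply, HForm_apply] using h₂.symm
    · simpa [prodForm_apply, HForm_apply] using h₁.symm

end Cancellation

lemma symmForm_K3Form : SymmForm K3Form :=
  symmForm_HForm.prod (symmForm_HForm.prod symmForm_HEEForm)

/-- The orthogonal complement in `Λ_K3` of two orthogonal hyperbolic planes is isometric to
`H ⊕ E₈ ⊕ E₈`. -/
lemma exists_isometry_HEE {F G τ T : K3type} (hFG : HypPair K3Form F G)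
    (hτT : HypPair K3Form τ T) (hFτ : K3Form F τ = 0) (hGτ : K3Form G τ = 0)
    (hFT : K3Form F T = 0) (hGT : K3Form G T = 0) :
    ∃ e : HEEtype →ₗ[ℤ] K3type, Function.Injective e ∧
      (∀ a b, K3Form (e a) (e b) = HEEForm a b) ∧
      ∀ z, (∃ a, e a = z) ↔
        K3Form F z = 0 ∧ K3Form G z = 0 ∧ K3Form τ z = 0 ∧ K3Form T z = 0 := by
  obtain ⟨e, he₁, he₂, he₃⟩ : ComplIsometric K3Form (prodForm HForm HEEForm) F G :=
    complIsometric_prodForm symmForm_HEEForm evenForm_HEEForm hFG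
  obtain ⟨t, rfl⟩ := (he₃ τ).2 ⟨hFτ, hGτ⟩
  obtain ⟨s, rfl⟩ := (he₃ T).2 ⟨hFT, hGT⟩
  obtain ⟨h₁, h₂, h₃⟩ := hτT
  rw [he₂] at h₁ h₂ h₃
  obtain ⟨e', he₁', he₂', he₃'⟩ : ComplIsometric (prodForm HForm HEEForm) HEEForm t s :=
    complIsometric_prodForm (symmForm_E8Form.prod symmForm_E8Form)
      (evenForm_E8Form.prod evenForm_E8Form) ⟨h₁, h₂, h₃⟩
  refine ⟨e.comp e', he₁.comp he₁', fun a b => by simp [he₂, he₂'], fun z => ⟨?_, ?_⟩⟩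
  · rintro ⟨a, rfl⟩
    have h := (he₃ (e (e' a))).1 ⟨_, rfl⟩
    have h' := (he₃' (e' a)).1 ⟨_, rfl⟩
    exact ⟨h.1, h.2, (he₂ _ _).trans h'.1, (he₂ _ _).trans h'.2⟩
  · rintro ⟨hF, hG, hτ, hT⟩
    obtain ⟨b, rfl⟩ := (he₃ z).2 ⟨hF, hG⟩
    rw [he₂] at hτ hT
    obtain ⟨a, rfl⟩ := (he₃' b).2 ⟨hτ, hT⟩
    exact ⟨a, rfl⟩

lemma mem_perpSub_span_pair {G : Type} [AddCommGroup G] {B : Bil G} (hB : SymmForm B)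
    {v w z : G} :
    z ∈ perpSub B (Submodule.span ℤ {v, w}) ↔ B v z = 0 ∧ B w z = 0 := by
  constructor
  · intro h
    exact ⟨(h v (Submodule.subset_span (by simp))).1, (h w (Submodule.subset_span (by simp))).1⟩
  · rintro ⟨hv, hw⟩ s hs
    obtain ⟨a, b, rfl⟩ := Submodule.mem_span_pair.1 hs
    rw [hB z]
    simp [hv, hw]

end DF

open DF in
/-- Let `Ľ ⊂ Λ_K3` be a nondegenerate primitive sublattice,
let `F ∈ Ľ` be `1`-admissible in `Ľ`, and let `τ ∈ Ľ^⊥` be `1`-admissible in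
`Ľ^⊥`. Then `Ľ = H' ⊕ Γ` orthogonally, with `H'` isometric to the hyperbolic
plane and `F` a primitive element of `H'`; moreover the inclusion
`Γ ↪ (ℤτ ⊕ ℤF)^⊥` factors through primitive embeddings
`Γ ↪ N ↪ (ℤτ ⊕ ℤF)^⊥` with `N` isometric to `H ⊕ E₈ ⊕ E₈`, whose composition
with the quotient map `(ℤτ ⊕ ℤF)^⊥ → (ℤτ ⊕ ℤF)^⊥/(ℤτ ⊕ ℤF)` is an isomorphism
of lattices. -/
theorem stmt16 (Lv : Submodule ℤ K3type) (hLnd : NondegOn K3Form Lv) (hLprim : PrimSub Lv)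
    (F τ : K3type)
    (hF : MAdm K3Form Lv F 1)
    (hτ : MAdm K3Form (perpSub K3Form Lv) τ 1) :
    ∃ H' Γ : Submodule ℤ K3type,
      H' ≤ Lv ∧ Γ ≤ Lv ∧
      -- orthogonal direct sum decomposition `Ľ = H' ⊕ Γ`:
      (∀ x ∈ H', ∀ y ∈ Γ, K3Form x y = 0) ∧
      H' ⊓ Γ = ⊥ ∧
      (∀ z ∈ Lv, ∃ x ∈ H', ∃ y ∈ Γ, z = x + y) ∧
      -- `H'` is isometric to the hyperbolic plane and contains `F` primitively:
      IsometricTo K3Form H' HForm ∧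
      F ∈ H' ∧ PrimEltIn H' F ∧
      -- the inclusion `Γ ↪ (ℤτ ⊕ ℤF)^⊥` factors through `N ≅ H ⊕ E₈ ⊕ E₈`:
      Γ ≤ perpSub K3Form (Submodule.span ℤ {τ, F}) ∧
      ∃ N : Submodule ℤ K3type,
        Γ ≤ N ∧ N ≤ perpSub K3Form (Submodule.span ℤ {τ, F}) ∧
        PrimIn Γ N ∧ PrimIn N (perpSub K3Form (Submodule.span ℤ {τ, F})) ∧
        ∃ (e : HEEtype ≃ₗ[ℤ] ↥N)
          (hNT : N ≤ perpSub K3Form (Submodule.span ℤ {τ, F})),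
          (∀ u v : HEEtype, K3Form ((e u : ↥N) : K3type) ((e v : ↥N) : K3type) =
            HEEForm u v) ∧
          -- the composition with the quotient map is an isomorphism:
          Function.Bijective (fun u : HEEtype =>
            (Submodule.Quotient.mk
              (⟨((e u : ↥N) : K3type), hNT (e u).2⟩ :
                ↥(perpSub K3Form (Submodule.span ℤ {τ, F}))) :
              ↥(perpSub K3Form (Submodule.span ℤ {τ, F})) ⧸
                Submodule.comap (perpSub K3Form (Submodule.span ℤ {τ, F})).subtype
                  (Submodule.span ℤ {τ, F}))) := by
  have hB : SymmForm K3Form := symmForm_K3Form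
  obtain ⟨hFL, -, hFF, -, G, hGL, hGG, -, hFG⟩ := hF
  obtain ⟨hτL, -, hττ, -, T, hTL, hTT, -, hτT⟩ := hτ
  have hLτ : ∀ z ∈ Lv, K3Form τ z = 0 := fun z hz => (hτL z hz).2
  have hLT : ∀ z ∈ Lv, K3Form T z = 0 := fun z hz => (hTL z hz).2
  have hFτ : K3Form F τ = 0 := (hτL F hFL).1
  have hGτ : K3Form G τ = 0 := (hτL G hGL).1
  have hFT : K3Form F T = 0 := (hTL F hFL).1
  have hGT : K3Form G T = 0 := (hTL G hGL).1
  have hτF := hLτ F hFL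
  have hTF := hLT F hFL
  have hGF : K3Form G F = 1 := by rw [hB, hFG]
  have hTτ : K3Form T τ = 1 := by rw [hB, hτT]
  obtain ⟨e, he₁, he₂, he₃⟩ := exists_isometry_HEE ⟨hFF, hGG, hFG⟩ ⟨hττ, hTT, hτT⟩
    hFτ hGτ hFT hGT
  have heF : ∀ a, K3Form F (e a) = 0 := fun a => ((he₃ _).1 ⟨a, rfl⟩).1
  have heG : ∀ a, K3Form G (e a) = 0 := fun a => ((he₃ _).1 ⟨a, rfl⟩).2.1
  have heτ : ∀ a, K3Form τ (e a) = 0 := fun a => ((he₃ _).1 ⟨a, rfl⟩).2.2.1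
  have heT : ∀ a, K3Form T (e a) = 0 := fun a => ((he₃ _).1 ⟨a, rfl⟩).2.2.2
  let h : (Fin 2 → ℤ) →ₗ[ℤ] K3type :=
    (LinearMap.proj 0).smulRight F + (LinearMap.proj 1).smulRight G
  have hh : ∀ u, h u = u 0 • F + u 1 • G := fun u => rfl
  have hinj : Function.Injective h := by
    rw [injective_iff_map_eq_zero]
    intro u hu
    have h0 := congrArg (K3Form G) hu
    have h1 := congrArg (K3Form F) hu
    rw [hh] at h0 h1
    simp only [map_add, map_smul, hGF, hGG, hFF, hFG, smul_eq_mul, map_zero] at h0 h1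
    funext i
    fin_cases i
    · simpa using h0
    · simpa using h1
  have hGperp : ∀ z : K3type, z ∈ perpSub K3Form (Submodule.span ℤ {F, G}) ↔
      K3Form F z = 0 ∧ K3Form G z = 0 := fun z => mem_perpSub_span_pair hB
  have hNperp : ∀ z : K3type, z ∈ perpSub K3Form (Submodule.span ℤ {τ, F}) ↔
      K3Form τ z = 0 ∧ K3Form F z = 0 := fun z => mem_perpSub_span_pair hB
  have hNT : LinearMap.range e ≤ perpSub K3Form (Submodule.span ℤ {τ, F}) := by
    rintro _ ⟨a, rfl⟩
    exact (hNperp _).2 ⟨heτ a, heF a⟩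
  refine ⟨LinearMap.range h, Lv ⊓ perpSub K3Form (Submodule.span ℤ {F, G}), ?_, inf_le_left,
    ?_, ?_, ?_, ?_, ?_, ?_, ?_, LinearMap.range e, ?_, hNT, ?_, ?_,
    LinearEquiv.ofInjective e he₁, hNT, fun u v => he₂ u v, ?_, ?_⟩
  · rintro _ ⟨u, rfl⟩
    exact Lv.add_mem (Lv.smul_mem _ hFL) (Lv.smul_mem _ hGL)
  · rintro _ ⟨u, rfl⟩ y ⟨-, hy⟩
    obtain ⟨hyF, hyG⟩ := (hGperp y).1 hy
    simp [-zsmul_eq_mul, hh, hyF, hyG]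
  · rw [Submodule.eq_bot_iff]
    rintro _ ⟨⟨u, rfl⟩, -, hu⟩
    obtain ⟨h1, h0⟩ := (hGperp _).1 hu
    rw [hh] at h0 h1
    simp only [map_add, map_smul, hGF, hGG, hFF, hFG, smul_eq_mul] at h0 h1
    have h0' : u 0 = 0 := by linarith
    have h1' : u 1 = 0 := by linarith
    rw [hh, h0', h1', zero_smul, zero_smul, add_zero]
  · intro z hz
    refine ⟨h ![K3Form G z, K3Form F z], ⟨_, rfl⟩, z - h ![K3Form G z, K3Form F z], ⟨?_, ?_⟩,
      by abel⟩
    · exact Lv.sub_mem hz (Lv.add_mem (Lv.smul_mem _ hFL) (Lv.smul_mem _ hGL))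
    · refine (hGperp _).2 ⟨?_, ?_⟩ <;> simp [-zsmul_eq_mul, hh, hFF, hFG, hGF, hGG]
  · refine ⟨LinearEquiv.ofInjective h hinj, fun u v => ?_⟩
    change K3Form (h u) (h v) = _
    simp [-zsmul_eq_mul, hh, HForm_apply, hFF, hFG, hGF, hGG]
  · exact ⟨![1, 0], by simp [hh]⟩
  · intro n x _ hx
    have := congrArg (K3Form G) hx
    rw [hGF, map_smul, smul_eq_mul] at this
    exact IsUnit.of_mul_eq_one _ this.symm
  · rintro z ⟨hz, hz'⟩
    exact (hNperp z).2 ⟨hLτ z hz, ((hGperp z).1 hz').1⟩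
  · rintro z ⟨hz, hz'⟩
    obtain ⟨h1, h2⟩ := (hGperp z).1 hz'
    exact (he₃ z).2 ⟨h1, h2, hLτ z hz, hLT z hz⟩
  · rintro n _ hn ⟨a, rfl⟩ ⟨hx, -⟩
    exact ⟨hLprim n _ hn hx, (hGperp _).2 ⟨heF a, heG a⟩⟩
  · rintro n x hn - hx
    obtain ⟨h1, h2, h3, h4⟩ := (he₃ _).1 hx
    simp only [map_smul, smul_eq_mul, mul_eq_zero, hn, false_or] at h1 h2 h3 h4
    exact (he₃ x).2 ⟨h1, h2, h3, h4⟩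
  · intro u v huv
    have hs := (Submodule.Quotient.eq _).1 huv
    obtain ⟨a, b, hab⟩ := Submodule.mem_span_pair.1 (Submodule.mem_comap.1 hs)
    change a • τ + b • F = e u - e v at hab
    have ha := congrArg (K3Form T) hab
    have hb := congrArg (K3Form G) hab
    simp only [map_add, map_sub, map_smul, smul_eq_mul, hTτ, hTF, hGτ, hGF, heT, heG] at ha hb
    have ha' : a = 0 := by linarith
    have hb' : b = 0 := by linarith
    rw [ha', hb', zero_smul, zero_smul, add_zero] at hab
    exact he₁ (sub_eq_zero.1 hab.symm)
  · intro w
    obtain ⟨⟨z, hz⟩, rfl⟩ := Submodule.Quotient.mk_surjective _ w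
    obtain ⟨hzτ, hzF⟩ := (hNperp z).1 hz
    obtain ⟨a, ha⟩ := (he₃ (z - K3Form T z • τ - K3Form G z • F)).2
      ⟨by simp [-zsmul_eq_mul, *], by simp [-zsmul_eq_mul, *], by simp [-zsmul_eq_mul, *], by simp [-zsmul_eq_mul, *]⟩
    refine ⟨a, (Submodule.Quotient.eq _).2 (Submodule.mem_comap.2 (Submodule.mem_span_pair.2
      ⟨-K3Form T z, -K3Form G z, ?_⟩))⟩
    change _ = e a - z
    rw [ha]
    simp only [neg_smul]
    abel
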